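/- arXiv:1511.07666 — 7 statements merged into one kernel-verified Lean document; each statement's English description precedes it below -/
import Mathlib

section
/- For all α, ε, λ > 0, the pushforward of Π₀ under the function c(v) = 1_{v > αε^α/λ} · (λv/α)^{1/α} equals Π_{α,ε,λ} + ∞·δ₀, where Π_{α,ε,λ}(dv) = 1_{v>ε} · λ v^{−α−1} dv is the Pareto-type Lévy measure with exponent α, cutoff ε and intensity λ. -/
open MeasureTheory Set

/-- The symmetric Cauchy measure `Π₀(dv) = v⁻² dv` on `ℝ ∖ {0}`. -/
noncomputable def Pi0 : Measure ℝ :=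
  volume.withDensity (fun v => ENNReal.ofReal (1 / v ^ 2))

/-- The Pareto-type Lévy measure `Π_{α,ε,λ}(dv) = 1_{v>ε} λ v^{-α-1} dv`. -/
noncomputable def paretoMeasure (α ε lam : ℝ) : Measure ℝ :=
  volume.withDensity (fun v => if ε < v then ENNReal.ofReal (lam / v ^ (α + 1)) else 0)

theorem Pi0_Ioo_zero_eq_top {T : ℝ} (hT : 0 < T) : Pi0 (Ioo 0 T) = ⊤ := by
  rw [Pi0, withDensity_apply _ measurableSet_Ioo]
  by_contra h
  have hmeas : Measurable fun v : ℝ => 1 / v ^ 2 := by fun_prop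
  have hint : IntegrableOn (fun v : ℝ => 1 / v ^ 2) (Ioo 0 T) := by
    refine ⟨hmeas.aestronglyMeasurable, ?_⟩
    rw [hasFiniteIntegral_iff_ofReal (Filter.Eventually.of_forall fun v => by positivity)]
    exact lt_top_iff_ne_top.2 h
  have hrpow : IntegrableOn (fun v : ℝ => v ^ (-2 : ℝ)) (Ioo 0 T) := by
    refine hint.congr_fun (fun v hv => ?_) measurableSet_Ioo
    simp only [Real.rpow_neg hv.1.le, Real.rpow_two, one_div]
  rw [intervalIntegral.integrableOn_Ioo_rpow_iff hT] at hrpow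
  norm_num at hrpow

theorem Pi0_image_pareto_inverse {α ε lam : ℝ} (hα : 0 < α) (hε : 0 < ε) (hlam : 0 < lam)
    {s : Set ℝ} (hs : MeasurableSet s)
    (himage : MeasurableSet ((fun u : ℝ => α * u ^ α / lam) '' (s ∩ Ioi ε))) :
    Pi0 ((fun u : ℝ => α * u ^ α / lam) '' (s ∩ Ioi ε)) = paretoMeasure α ε lam s := by
  have hpos : ∀ u ∈ s ∩ Ioi ε, 0 < u := fun u hu => hε.trans hu.2
  have hderiv : ∀ u ∈ s ∩ Ioi ε, HasDerivWithinAt (fun u : ℝ => α * u ^ α / lam)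
      (α * (α * u ^ (α - 1)) / lam) (s ∩ Ioi ε) u := fun u hu =>
    (((Real.hasDerivAt_rpow_const (Or.inl (hpos u hu).ne')).const_mul α).div_const
      lam).hasDerivWithinAt
  have hinj : InjOn (fun u : ℝ => α * u ^ α / lam) (s ∩ Ioi ε) := by
    intro u hu v hv huv
    have h : u ^ α = v ^ α := by
      simpa [div_left_inj' hlam.ne', hα.ne'] using huv
    exact (Real.rpow_left_inj (hpos u hu).le (hpos v hv).le hα.ne').1 h
  have hpareto : paretoMeasure α ε lam s =
      ∫⁻ u in s ∩ Ioi ε, ENNReal.ofReal (lam / u ^ (α + 1)) := by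
    rw [paretoMeasure, withDensity_apply _ hs, inter_comm,
      ← setLIntegral_indicator measurableSet_Ioi]
    rfl
  rw [hpareto, Pi0, withDensity_apply _ himage,
    lintegral_image_eq_lintegral_abs_deriv_mul (hs.inter measurableSet_Ioi) hderiv hinj]
  refine setLIntegral_congr_fun (hs.inter measurableSet_Ioi) fun u hu => ?_
  have hu0 := hpos u hu
  rw [← ENNReal.ofReal_mul (abs_nonneg _), abs_of_pos (by positivity),
    Real.rpow_sub_one hu0.ne', Real.rpow_add_one hu0.ne']
  congr 1
  field_simp

theorem measurable_pareto_transport (α ε lam : ℝ) :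
    Measurable (fun v : ℝ =>
      if α * ε ^ α / lam < v then (lam * v / α) ^ (1 / α) else 0) :=
  Measurable.ite measurableSet_Ioi (by fun_prop) measurable_const

theorem preimage_inter_Ioi_eq_image {α ε lam : ℝ} (hα : 0 < α) (hε : 0 < ε) (hlam : 0 < lam)
    (s : Set ℝ) :
    (fun v : ℝ => if α * ε ^ α / lam < v then (lam * v / α) ^ (1 / α) else 0) ⁻¹' s ∩
        Ioi (α * ε ^ α / lam) =
      (fun u : ℝ => α * u ^ α / lam) '' (s ∩ Ioi ε) := by
  ext v
  constructor
  · rintro ⟨hvs, hv⟩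
    rw [mem_Ioi] at hv
    rw [mem_preimage, if_pos hv] at hvs
    have hv0 : 0 < v := lt_trans (by positivity) hv
    have hbase : 0 < lam * v / α := by positivity
    refine ⟨_, ⟨hvs, ?_⟩, ?_⟩
    · rw [mem_Ioi, one_div, Real.lt_rpow_inv_iff_of_pos hε.le hbase.le hα, lt_div_iff₀ hα]
      rw [div_lt_iff₀ hlam] at hv
      linarith
    · simp only [one_div]
      rw [Real.rpow_inv_rpow hbase.le hα.ne']
      field_simp
  · rintro ⟨u, ⟨hus, hu⟩, rfl⟩
    have hu0 : 0 < u := hε.trans hu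
    have hlt : α * ε ^ α / lam < α * u ^ α / lam := by
      have := Real.rpow_lt_rpow hε.le hu hα
      gcongr
    refine ⟨?_, hlt⟩
    have hinv : lam * (α * u ^ α / lam) / α = u ^ α := by field_simp
    rw [mem_preimage, if_pos hlt, hinv, one_div, Real.rpow_rpow_inv hu0.le hα.ne']
    exact hus

/-- The pushforward of `Π₀` under `c(v) = 1_{v > αε^α/λ} (λv/α)^{1/α}` equals
`Π_{α,ε,λ} + ∞·δ₀`. -/
theorem map_pareto_transport (α ε lam : ℝ) (hα : 0 < α) (hε : 0 < ε) (hlam : 0 < lam) :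
    Measure.map (fun v : ℝ => if α * ε ^ α / lam < v then (lam * v / α) ^ (1 / α) else 0)
        Pi0 =
      paretoMeasure α ε lam + (⊤ : ENNReal) • Measure.dirac 0 := by
  have hc := measurable_pareto_transport α ε lam
  have hT : 0 < α * ε ^ α / lam := by positivity
  ext s hs
  have himage := preimage_inter_Ioi_eq_image hα hε hlam s
  rw [Measure.map_apply hc hs, ← measure_inter_add_sdiff _ measurableSet_Ioi, himage,
    Pi0_image_pareto_inverse hα hε hlam hs (himage ▸ (hc hs).inter measurableSet_Ioi),
    Measure.add_apply, Measure.smul_apply, Measure.dirac_apply' _ hs, smul_eq_mul]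
  congr 1
  by_cases h0 : (0 : ℝ) ∈ s
  · rw [indicator_of_mem h0, Pi.one_apply, mul_one, eq_top_iff, ← Pi0_Ioo_zero_eq_top hT]
    refine measure_mono fun v hv => ⟨?_, not_lt.2 hv.2.le⟩
    rw [mem_preimage, if_neg (not_lt.2 hv.2.le)]
    exact h0
  · rw [indicator_of_notMem h0, mul_zero]
    convert measure_empty (μ := Pi0)
    refine eq_empty_of_forall_notMem fun v ⟨hvs, hv⟩ => h0 ?_
    rwa [mem_preimage, if_neg (by simpa using hv)] at hvs
end

section
/- Let ε > 0, n ∈ ℕ with n ≥ 1, and let ξ₁, …, ξₙ be real numbers with ξᵢ > ε for all i; denote by ε < ξ_{1:n} ≤ ξ_{2:n} ≤ ⋯ ≤ ξ_{n:n} their nondecreasing rearrangement (order statistics). Define c : ℝ → ℝ by c(v) = 0 for v < 1, c(v) = ξ_{i:n} for v ∈ [n/(n−i+1), n/(n−i)) and i ∈ {1, …, n−1}, and c(v) = ξ_{n:n} for v ≥ n. Then the pushforward of Π₀ under c equals (1/n) ∑_{i=1}^n δ_{ξᵢ} + ∞·δ₀; in particular, on ℝ∖{0} it coincides with the empirical measure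 Π_n of the sample ξ₁, …, ξₙ. -/
open MeasureTheory Set

theorem MeasureTheory.Measure.map_eq_sum_smul_dirac {α β ι : Type*} [MeasurableSpace α]
    [MeasurableSpace β] [Fintype ι] (μ : Measure α) {S : ι → Set α}
    (hS : ∀ i, MeasurableSet (S i)) (hd : Pairwise (Function.onFun Disjoint S))
    (hU : ⋃ i, S i = univ) {c : α → β} {g : ι → β} (hc : ∀ i, ∀ v ∈ S i, c v = g i) :
    μ.map c = ∑ i, μ (S i) • Measure.dirac (g i) := by
  have hμ : μ = Measure.sum fun i => μ.restrict (S i) := by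
    rw [← Measure.restrict_iUnion hd hS, hU, Measure.restrict_univ]
  have hae : ∀ i, c =ᵐ[μ.restrict (S i)] fun _ => g i := fun i =>
    (ae_restrict_iff' (hS i)).2 (ae_of_all _ (hc i))
  have hm : ∀ i, AEMeasurable c (μ.restrict (S i)) := fun i =>
    aemeasurable_const.congr (hae i).symm
  conv_lhs => rw [hμ]
  rw [Measure.map_sum (AEMeasurable.sum_measure hm), Measure.sum_fintype]
  refine Finset.sum_congr rfl fun i _ => ?_
  rw [Measure.map_congr (hae i), Measure.map_const, Measure.restrict_apply_univ]

theorem Pi0_Ici {a : ℝ} (ha : 0 < a) : Pi0 (Ici a) = ENNReal.ofReal (1 / a) := by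
  have hpow : EqOn (fun v : ℝ => v ^ (-2 : ℝ)) (fun v => 1 / v ^ 2) (Ioi a) := by
    intro v hv
    have hv0 : 0 < v := ha.trans hv
    simp [Real.rpow_neg hv0.le]
  have hint : IntegrableOn (fun v : ℝ => 1 / v ^ 2) (Ioi a) :=
    (integrableOn_Ioi_rpow_of_lt (by norm_num : (-2 : ℝ) < -1) ha).congr_fun hpow
      measurableSet_Ioi
  rw [Pi0, withDensity_apply _ measurableSet_Ici, setLIntegral_congr Ioi_ae_eq_Ici.symm,
    ← ofReal_integral_eq_lintegral_ofReal hint (ae_of_all _ fun v => by positivity),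
    ← setIntegral_congr_fun measurableSet_Ioi hpow,
    integral_Ioi_rpow_of_lt (by norm_num) ha]
  congr 1
  norm_num [Real.rpow_neg_one]

theorem Pi0_Ico {a b : ℝ} (ha : 0 < a) (hab : a ≤ b) :
    Pi0 (Ico a b) = ENNReal.ofReal (1 / a - 1 / b) := by
  have hb : 0 < b := ha.trans_le hab
  rw [← Ici_sdiff_Ici, measure_sdiff (Ici_subset_Ici.2 hab) measurableSet_Ici.nullMeasurableSet
    (by simp [Pi0_Ici hb]), Pi0_Ici ha, Pi0_Ici hb, ENNReal.ofReal_sub _ (by positivity)]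

theorem Pi0_Iio {b : ℝ} (hb : 0 < b) : Pi0 (Iio b) = ⊤ := by
  refine ENNReal.eq_top_of_forall_nnreal_le fun r => ?_
  have ha : 0 < ((r : ℝ) + 1 / b)⁻¹ := by positivity
  have hab : ((r : ℝ) + 1 / b)⁻¹ ≤ b := by
    rw [inv_le_comm₀ (by positivity) hb]
    simp
  calc (r : ENNReal) = Pi0 (Ico ((r : ℝ) + 1 / b)⁻¹ b) := by rw [Pi0_Ico ha hab]; simp
    _ ≤ Pi0 (Iio b) := measure_mono Ico_subset_Iio_self

/-- The set of `v ≥ 1` such that `n / v` lies in `(n - i - 1, n - i]`. -/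
def transportPiece (n i : ℕ) : Set ℝ := {v | 1 ≤ v ∧ ⌈(n : ℝ) / v⌉₊ = n - i}

theorem measurableSet_transportPiece (n i : ℕ) : MeasurableSet (transportPiece n i) :=
  measurableSet_Ici.inter
    ((Nat.measurable_ceil.comp (measurable_const.div measurable_id)) (measurableSet_singleton _))

theorem mem_transportPiece_iff {n i : ℕ} (hi : i < n) {v : ℝ} :
    v ∈ transportPiece n i ↔
      (n : ℝ) / ((n : ℝ) - i) ≤ v ∧ ((n : ℝ) - i - 1) * v < n := by
  have hin : (i : ℝ) < n := by exact_mod_cast hi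
  have hd : (0 : ℝ) < (n : ℝ) - i := by linarith
  have h1 : 1 ≤ (n : ℝ) / ((n : ℝ) - i) := by
    rw [one_le_div hd]
    linarith [(Nat.cast_nonneg i : (0 : ℝ) ≤ i)]
  have key : 1 ≤ v → (⌈(n : ℝ) / v⌉₊ = n - i ↔
      (n : ℝ) / ((n : ℝ) - i) ≤ v ∧ ((n : ℝ) - i - 1) * v < n) := fun hv => by
    have hv0 : 0 < v := by linarith
    rw [Nat.ceil_eq_iff (by omega), Nat.cast_sub (by omega), Nat.cast_sub (by omega),
      lt_div_iff₀ hv0, div_le_iff₀ hv0, div_le_iff₀ hd, and_comm, mul_comm v]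
    push_cast
    rfl
  exact ⟨fun h => (key h.1).1 h.2, fun h => ⟨h1.trans h.1, (key (h1.trans h.1)).2 h⟩⟩

theorem transportPiece_eq_Ico {n i : ℕ} (hi : i < n - 1) :
    transportPiece n i = Ico ((n : ℝ) / ((n : ℝ) - i)) ((n : ℝ) / ((n : ℝ) - i - 1)) := by
  have hin : ((i + 1 : ℕ) : ℝ) < n := by exact_mod_cast (by omega : i + 1 < n)
  push_cast at hin
  ext v
  rw [mem_transportPiece_iff (by omega), mem_Ico, lt_div_iff₀ (by linarith), mul_comm v]

theorem transportPiece_eq_Ici {n : ℕ} (hn : 1 ≤ n) :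
    transportPiece n (n - 1) = Ici (n : ℝ) := by
  have : (1 : ℝ) ≤ n := by exact_mod_cast hn
  ext v
  rw [mem_transportPiece_iff (by omega), Nat.cast_sub hn]
  simp only [Nat.cast_one, sub_sub_cancel, div_one, sub_self, zero_mul, mem_Ici,
    and_iff_left_iff_imp]
  intro
  linarith

theorem Pi0_transportPiece {n i : ℕ} (hi : i < n) :
    Pi0 (transportPiece n i) = (n : ENNReal)⁻¹ := by
  have hn : (0 : ℝ) < n := by exact_mod_cast (by omega : 0 < n)
  have hinv : (n : ENNReal)⁻¹ = ENNReal.ofReal (1 / n) := by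
    rw [one_div, ENNReal.ofReal_inv_of_pos hn, ENNReal.ofReal_natCast]
  rw [hinv]
  rcases (by omega : i < n - 1 ∨ i = n - 1) with h | rfl
  · have hin : ((i + 1 : ℕ) : ℝ) < n := by exact_mod_cast (by omega : i + 1 < n)
    push_cast at hin
    have h1 : (0 : ℝ) < (n : ℝ) - i - 1 := by linarith
    have h2 : (0 : ℝ) < (n : ℝ) - i := by linarith
    rw [transportPiece_eq_Ico h, Pi0_Ico (by positivity)
      (div_le_div_of_nonneg_left hn.le h1 (by linarith))]
    congr 1
    field_simp
    ring
  · rw [transportPiece_eq_Ici (by omega), Pi0_Ici hn]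

theorem exists_mem_transportPiece {n : ℕ} (hn : 1 ≤ n) {v : ℝ} (hv : 1 ≤ v) :
    ∃ i : Fin n, v ∈ transportPiece n i := by
  have hn' : (0 : ℝ) < n := by exact_mod_cast hn
  have hpos : 0 < ⌈(n : ℝ) / v⌉₊ := Nat.ceil_pos.2 (by positivity)
  have hle : ⌈(n : ℝ) / v⌉₊ ≤ n := Nat.ceil_le.2 (div_le_self hn'.le hv)
  exact ⟨⟨n - ⌈(n : ℝ) / v⌉₊, by omega⟩, hv, by dsimp only; omega⟩

/-- The pushforward of `Π₀` under the piecewise-constant transport function built from the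
order statistics `ξs` of a sample `ξ₁,…,ξₙ ∈ (ε,∞)` is the empirical measure
`(1/n) ∑ δ_{ξᵢ}` plus an infinite point mass at `0`.
(Here `ξs` is the nondecreasing rearrangement of `ξ`, 0-indexed: `ξs i = ξ_{i+1:n}`.) -/
theorem map_empirical_transport (ε : ℝ) (hε : 0 < ε) (n : ℕ) (hn : 1 ≤ n)
    (ξ ξs : Fin n → ℝ) (hξ : ∀ i, ε < ξ i)
    (hmono : Monotone ξs) (hperm : ∃ σ : Equiv.Perm (Fin n), ξs = ξ ∘ σ)
    (c : ℝ → ℝ)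
    (hc0 : ∀ v : ℝ, v < 1 → c v = 0)
    (hci : ∀ i : Fin n, (i : ℕ) < n - 1 → ∀ v : ℝ,
      (n : ℝ) / ((n : ℝ) - (i : ℕ)) ≤ v → v < (n : ℝ) / ((n : ℝ) - (i : ℕ) - 1) →
        c v = ξs i)
    (hcn : ∀ v : ℝ, (n : ℝ) ≤ v → c v = ξs ⟨n - 1, by omega⟩) :
    Measure.map c Pi0 =
      (n : ENNReal)⁻¹ • (∑ i, Measure.dirac (ξ i)) + (⊤ : ENNReal) • Measure.dirac 0 := by
  let S : Option (Fin n) → Set ℝ := fun o => o.elim (Iio 1) fun i => transportPiece n i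
  let g : Option (Fin n) → ℝ := fun o => o.elim 0 ξs
  have hS : ∀ o, MeasurableSet (S o) := by
    rintro (_ | i)
    exacts [measurableSet_Iio, measurableSet_transportPiece n i]
  have hd : Pairwise (Function.onFun Disjoint S) := by
    rintro (_ | i) (_ | j) hij <;> refine Set.disjoint_left.2 fun v hv hv' => ?_
    · exact hij rfl
    · exact absurd hv'.1 (not_le.2 hv)
    · exact absurd hv.1 (not_le.2 hv')
    · refine hij (congrArg some (Fin.ext ?_))
      have : n - (i : ℕ) = n - j := hv.2.symm.trans hv'.2
      omega
  have hU : ⋃ o, S o = univ := by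
    refine eq_univ_of_forall fun v => mem_iUnion.2 ?_
    rcases lt_or_ge v 1 with hv | hv
    · exact ⟨none, hv⟩
    · obtain ⟨i, hi⟩ := exists_mem_transportPiece hn hv
      exact ⟨some i, hi⟩
  have hc : ∀ o, ∀ v ∈ S o, c v = g o := by
    rintro (_ | ⟨i, hi⟩) v hv
    · exact hc0 v hv
    · change v ∈ transportPiece n i at hv
      change c v = ξs ⟨i, hi⟩
      rcases (by omega : i < n - 1 ∨ i = n - 1) with h | rfl
      · rw [transportPiece_eq_Ico h] at hv
        exact hci ⟨i, hi⟩ h v hv.1 hv.2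
      · rw [transportPiece_eq_Ici hn] at hv
        exact hcn v hv
  obtain ⟨σ, rfl⟩ := hperm
  rw [Measure.map_eq_sum_smul_dirac Pi0 hS hd hU hc, Fintype.sum_option, add_comm,
    ← Equiv.sum_comp σ fun i => Measure.dirac (ξ i), Finset.smul_sum]
  congr 1
  · exact Finset.sum_congr rfl fun i _ => congrArg (· • _) (Pi0_transportPiece i.2)
  · exact congrArg (· • _) (Pi0_Iio one_pos)
end

section
/- Fix p ≥ 1. For standard Lévy measures Π₁, Π₂, Π₃ in L^p_ρ with (unique) transportation functions c₁, c₂, c₃ (i.e. Π₀ ∘ cᵢ⁻¹ = Π̃ᵢ), the transportation distance T_p(Π₁, Π₂) := (∫ (|c₁(v) − c₂(v)| ∧ 1)^p Π₀(dv))^{1/p} is a metric on L^p_ρ: it is finite, symmetric, satisfies the triangle inequality T_p(Π₁, Π₃) ≤ T_p(Π₁, Π₂) + T_p(Π₂, Π₃), and T_p(Π₁, Π₂) = 0 if and only if Π₁ = Π₂. -/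
open MeasureTheory Set

/-- A transportation function: nondecreasing, maps `(-∞,0]` into `(-∞,0]` and
`[0,∞)` into `[0,∞)`, left-continuous on `(-∞,0]`, right-continuous on `[0,∞)`. -/
def IsTransportFn (c : ℝ → ℝ) : Prop :=
  Monotone c ∧ MapsTo c (Iic 0) (Iic 0) ∧ MapsTo c (Ici 0) (Ici 0) ∧
    (∀ x ≤ 0, ContinuousWithinAt c (Iic x) x) ∧
    (∀ x ≥ 0, ContinuousWithinAt c (Ici x) x)

/-- `Π̃ = Π` if `Π(ℝ) = ∞`, and `Π̃ = Π + ∞·δ₀` otherwise. -/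
noncomputable def levyTilde (P : Measure ℝ) : Measure ℝ :=
  if P Set.univ = ⊤ then P else P + (⊤ : ENNReal) • Measure.dirac 0

/-- A standard Lévy measure in the class `L^p_ρ`. -/
def IsLevyLp (p : ℝ) (P : Measure ℝ) : Prop :=
  SigmaFinite P ∧ P {0} = 0 ∧ (∫⁻ v, ENNReal.ofReal (min (v ^ 2) 1) ∂P < ⊤) ∧
    (∫⁻ v, ENNReal.ofReal ((min |v| 1) ^ p) ∂P < ⊤)

/-- The transportation distance of order `p`, expressed through the
transportation functions `c₁, c₂` of the two measures. -/
noncomputable def Tdist (p : ℝ) (c₁ c₂ : ℝ → ℝ) : ENNReal :=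
  (∫⁻ v, ENNReal.ofReal (min |c₁ v - c₂ v| 1) ^ p ∂Pi0) ^ (1 / p)

lemma IsTransportFn.map_zero {c : ℝ → ℝ} (hc : IsTransportFn c) : c 0 = 0 :=
  le_antisymm (hc.2.1 (mem_Iic.2 le_rfl)) (hc.2.2.1 (mem_Ici.2 le_rfl))

lemma IsTransportFn.measurable {c : ℝ → ℝ} (hc : IsTransportFn c) : Measurable c :=
  hc.1.measurable

lemma Pi0_compl_ball_lt_top {a : ℝ} (ha : 0 < a) : Pi0 {x | a ≤ |x|} < ⊤ := by
  have hs : MeasurableSet {x : ℝ | a ≤ |x|} := measurableSet_le measurable_const (by fun_prop)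
  have hint : Integrable (fun x : ℝ => (1 + 1 / a ^ 2) * (1 + x ^ 2)⁻¹) :=
    integrable_inv_one_add_sq.const_mul _
  rw [Pi0, withDensity_apply _ hs]
  calc ∫⁻ x in {x : ℝ | a ≤ |x|}, ENNReal.ofReal (1 / x ^ 2)
      ≤ ∫⁻ x in {x : ℝ | a ≤ |x|}, ENNReal.ofReal ((1 + 1 / a ^ 2) * (1 + x ^ 2)⁻¹) := by
        refine setLIntegral_mono (by fun_prop) fun x hx => ENNReal.ofReal_le_ofReal ?_
        have h : a ^ 2 ≤ x ^ 2 := by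
          rw [← sq_abs x]; exact pow_le_pow_left₀ ha.le hx 2
        have ha2 : 0 < a ^ 2 := by positivity
        have hx2 : 0 < x ^ 2 := ha2.trans_le h
        rw [← div_eq_mul_inv, div_le_div_iff₀ hx2 (by positivity), add_mul, one_div_mul_eq_div]
        have : 1 ≤ x ^ 2 / a ^ 2 := (one_le_div ha2).2 h
        linarith
    _ ≤ ∫⁻ x, ENNReal.ofReal ((1 + 1 / a ^ 2) * (1 + x ^ 2)⁻¹) := setLIntegral_le_lintegral _ _
    _ < ⊤ := hint.lintegral_lt_top

lemma Pi0_ne_zero_of_volume_ne_zero {s : Set ℝ} (h0 : (0 : ℝ) ∉ s) (hs : volume s ≠ 0) :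
    Pi0 s ≠ 0 := by
  rw [Pi0, Ne, withDensity_apply_eq_zero (by fun_prop)]
  convert hs using 3
  refine inter_eq_right.2 fun x hx => ?_
  have : x ≠ 0 := fun h => h0 (h ▸ hx)
  simp only [mem_ofPred_eq, ne_eq, ENNReal.ofReal_eq_zero, not_le]
  positivity

/-- `Pi0` strictly separates nested sets which are bounded away from `0` and differ by at least
an interval. -/
lemma Pi0_lt_Pi0_of_Ioo {s t : Set ℝ} {a u v : ℝ} (ha : 0 < a) (hsa : ∀ x ∈ s, a ≤ |x|)
    (hst : s ⊆ t) (huv : u < v) (h0 : (0 : ℝ) ∉ Ioo u v) (hs : Disjoint s (Ioo u v))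
    (ht : Ioo u v ⊆ t) : Pi0 s < Pi0 t := by
  have hfin : Pi0 s ≠ ⊤ := ((measure_mono hsa).trans_lt (Pi0_compl_ball_lt_top ha)).ne
  have hpos : Pi0 (Ioo u v) ≠ 0 := Pi0_ne_zero_of_volume_ne_zero h0 (by simpa using huv)
  calc Pi0 s < Pi0 s + Pi0 (Ioo u v) := ENNReal.lt_add_right hfin hpos
    _ = Pi0 (s ∪ Ioo u v) := (measure_union hs measurableSet_Ioo).symm
    _ ≤ Pi0 t := measure_mono (union_subset hst ht)

lemma IsTransportFn.le_of_map_eq {c d : ℝ → ℝ} (hc : IsTransportFn c) (hd : IsTransportFn d)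
    (h : Measure.map c Pi0 = Measure.map d Pi0) (v : ℝ) : d v ≤ c v := by
  by_contra! hlt
  obtain ⟨y, hcy, hyd⟩ := exists_between hlt
  rcases lt_trichotomy v 0 with hv | rfl | hv
  · obtain ⟨u, huv, hu⟩ : ∃ u < v, y < d u :=
      ((((hd.2.2.2.1 v hv.le).mono Iio_subset_Iic_self).eventually_const_lt hyd).and
        self_mem_nhdsWithin).exists.imp fun _ hx => ⟨hx.2, hx.1⟩
    have hsub : ∀ x, d x ≤ y → x < u := fun x hx => hd.1.reflect_lt (hx.trans_lt hu)
    have key : Pi0 (d ⁻¹' Iic y) < Pi0 (c ⁻¹' Iic y) := by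
      refine (measure_mono (t := Iio u) hsub).trans_lt
        ((Pi0_lt_Pi0_of_Ioo (a := -v) (t := Iic v) (u := u) (v := v) (by linarith)
          (fun x hx => ?_) (fun x hx => ?_) huv (fun h0 => ?_) ?_
          (fun x hx => hx.2.le)).trans_le
          (measure_mono fun x hx => (hc.1 hx).trans hcy.le))
      · exact le_abs.2 (Or.inr (by linarith [mem_Iio.1 hx]))
      · exact (mem_Iio.1 hx).le.trans huv.le
      · linarith [h0.2]
      · exact disjoint_left.2 fun x hx hx' => lt_asymm hx hx'.1
    rw [← Measure.map_apply hd.measurable measurableSet_Iic,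
      ← Measure.map_apply hc.measurable measurableSet_Iic, h] at key
    exact key.false
  · rw [hc.map_zero, hd.map_zero] at hlt
    exact hlt.false
  · obtain ⟨u, hvu, hu⟩ : ∃ u > v, c u < y :=
      ((((hc.2.2.2.2 v hv.le).mono Ioi_subset_Ici_self).eventually_lt_const hcy).and
        self_mem_nhdsWithin).exists.imp fun _ hx => ⟨hx.2, hx.1⟩
    have hsub : ∀ x, y ≤ c x → u < x := fun x hx => hc.1.reflect_lt (hu.trans_le hx)
    have key : Pi0 (c ⁻¹' Ici y) < Pi0 (d ⁻¹' Ici y) := by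
      refine (measure_mono (t := Ioi u) hsub).trans_lt
        ((Pi0_lt_Pi0_of_Ioo (a := v) (t := Ici v) (u := v) (v := u) hv
          (fun x hx => ?_) (fun x hx => ?_) hvu (fun h0 => ?_) ?_
          (fun x hx => hx.1.le)).trans_le
          (measure_mono fun x hx => hyd.le.trans (hd.1 hx)))
      · exact le_abs.2 (Or.inl (by linarith [mem_Ioi.1 hx]))
      · exact hvu.le.trans (mem_Ioi.1 hx).le
      · linarith [h0.1]
      · exact disjoint_left.2 fun x hx hx' => lt_asymm hx hx'.2
    rw [← Measure.map_apply hd.measurable measurableSet_Ici,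
      ← Measure.map_apply hc.measurable measurableSet_Ici, h] at key
    exact key.false

/-- Transportation functions are determined by the image of `Pi0`. -/
lemma IsTransportFn.eq_of_map_eq {c d : ℝ → ℝ} (hc : IsTransportFn c) (hd : IsTransportFn d)
    (h : Measure.map c Pi0 = Measure.map d Pi0) : c = d :=
  funext fun v => le_antisymm (hd.le_of_map_eq hc h.symm v) (hc.le_of_map_eq hd h v)

lemma levyTilde_restrict_compl_zero {P : Measure ℝ} (h0 : P {0} = 0) :
    (levyTilde P).restrict {0}ᶜ = P := by
  have hP : P.restrict {0}ᶜ = P :=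
    Measure.restrict_eq_self_of_ae_mem (compl_mem_ae_iff.2 h0)
  unfold levyTilde
  split_ifs
  · exact hP
  · rw [Measure.restrict_add, hP, Measure.restrict_smul,
      Measure.restrict_eq_zero.2 (by simp : Measure.dirac (0 : ℝ) {0}ᶜ = 0), smul_zero, add_zero]

lemma lintegral_levyTilde {P : Measure ℝ} {f : ℝ → ENNReal} (hf : f 0 = 0) :
    ∫⁻ v, f v ∂levyTilde P = ∫⁻ v, f v ∂P := by
  unfold levyTilde
  split_ifs
  · rfl
  · rw [lintegral_add_measure, lintegral_smul_measure, lintegral_dirac, hf]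
    simp

lemma Tdist_comm (p : ℝ) (c d : ℝ → ℝ) : Tdist p c d = Tdist p d c := by
  simp only [Tdist, abs_sub_comm]

lemma Tdist_triangle {p : ℝ} (hp : 1 ≤ p) {c d e : ℝ → ℝ} (hc : Measurable c)
    (hd : Measurable d) (he : Measurable e) : Tdist p c e ≤ Tdist p c d + Tdist p d e := by
  refine le_trans (ENNReal.rpow_le_rpow (lintegral_mono fun v => ?_) (by positivity))
    (ENNReal.lintegral_Lp_add_le (p := p)
      (f := fun v => ENNReal.ofReal (min |c v - d v| 1))
      (g := fun v => ENNReal.ofReal (min |d v - e v| 1)) (by fun_prop) (by fun_prop) hp)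
  refine ENNReal.rpow_le_rpow ?_ (by linarith)
  rw [Pi.add_apply, ← ENNReal.ofReal_add (by positivity) (by positivity)]
  refine ENNReal.ofReal_le_ofReal ?_
  have := abs_sub_le (c v) (d v) (e v)
  have := abs_nonneg (c v - d v)
  have := abs_nonneg (d v - e v)
  grind

lemma Tdist_zero_right_lt_top {p : ℝ} (hp : 1 ≤ p) {P : Measure ℝ} (hP : IsLevyLp p P)
    {c : ℝ → ℝ} (hc : Measurable c) (hmap : Measure.map c Pi0 = levyTilde P) :
    Tdist p c 0 < ⊤ := by
  have hp0 : 0 < p := by linarith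
  refine ENNReal.rpow_lt_top_of_nonneg (by positivity) (LT.lt.ne ?_)
  calc ∫⁻ v, ENNReal.ofReal (min |c v - (0 : ℝ → ℝ) v| 1) ^ p ∂Pi0
      = ∫⁻ v, ENNReal.ofReal (min |v| 1 ^ p) ∂Measure.map c Pi0 := by
        rw [lintegral_map (by fun_prop) hc]
        refine lintegral_congr fun v => ?_
        rw [ENNReal.ofReal_rpow_of_nonneg (by positivity) hp0.le, Pi.zero_apply, sub_zero]
    _ = ∫⁻ v, ENNReal.ofReal (min |v| 1 ^ p) ∂P := by
        rw [hmap, lintegral_levyTilde]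
        simp [hp0.ne']
    _ < ⊤ := hP.2.2.2

lemma Tdist_eq_zero_iff {p : ℝ} (hp : 1 ≤ p) {c d : ℝ → ℝ} (hc : Measurable c)
    (hd : Measurable d) : Tdist p c d = 0 ↔ c =ᵐ[Pi0] d := by
  have hp0 : 0 < p := by linarith
  rw [Tdist, ENNReal.rpow_eq_zero_iff_of_pos (by positivity), lintegral_eq_zero_iff (by fun_prop)]
  refine Filter.eventually_congr (Filter.Eventually.of_forall fun v => ?_)
  rw [Pi.zero_apply, ENNReal.rpow_eq_zero_iff_of_pos hp0, ENNReal.ofReal_eq_zero, min_le_iff,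
    abs_nonpos_iff, sub_eq_zero]
  norm_num

/-- `T_p` is a (finite) metric on the class `L^p_ρ` of standard Lévy measures:
finiteness, symmetry, triangle inequality and non-degeneracy. -/
theorem transportation_distance_is_metric (p : ℝ) (hp : 1 ≤ p)
    (P₁ P₂ P₃ : Measure ℝ)
    (h₁ : IsLevyLp p P₁) (h₂ : IsLevyLp p P₂) (h₃ : IsLevyLp p P₃)
    (c₁ c₂ c₃ : ℝ → ℝ)
    (hc₁ : IsTransportFn c₁ ∧ Measure.map c₁ Pi0 = levyTilde P₁)
    (hc₂ : IsTransportFn c₂ ∧ Measure.map c₂ Pi0 = levyTilde P₂)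
    (hc₃ : IsTransportFn c₃ ∧ Measure.map c₃ Pi0 = levyTilde P₃) :
    Tdist p c₁ c₂ < ⊤ ∧
    Tdist p c₁ c₂ = Tdist p c₂ c₁ ∧
    Tdist p c₁ c₃ ≤ Tdist p c₁ c₂ + Tdist p c₂ c₃ ∧
    (Tdist p c₁ c₂ = 0 ↔ P₁ = P₂) := by
  obtain ⟨ht₁, hm₁⟩ := hc₁
  obtain ⟨ht₂, hm₂⟩ := hc₂
  have hc₁ := ht₁.measurable
  have hc₂ := ht₂.measurable
  refine ⟨?_, Tdist_comm p c₁ c₂, Tdist_triangle hp hc₁ hc₂ hc₃.1.measurable, ?_⟩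
  · refine (Tdist_triangle hp hc₁ (d := 0) measurable_const hc₂).trans_lt ?_
    rw [Tdist_comm p 0 c₂]
    exact ENNReal.add_lt_top.2
      ⟨Tdist_zero_right_lt_top hp h₁ hc₁ hm₁, Tdist_zero_right_lt_top hp h₂ hc₂ hm₂⟩
  · rw [Tdist_eq_zero_iff hp hc₁ hc₂]
    refine ⟨fun h => ?_, fun h => ?_⟩
    · rw [← levyTilde_restrict_compl_zero h₁.2.1, ← levyTilde_restrict_compl_zero h₂.2.1,
        ← hm₁, ← hm₂, Measure.map_congr h]
    · rw [ht₁.eq_of_map_eq ht₂ (by rw [hm₁, hm₂, h])]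
end

section
/- For α > 1 define c_α : ℝ → ℝ by c_α(v) = (v/α)^{1/α} for v > α^{1/α} and c_α(v) = 0 otherwise (the transportation function of a one-sided Pareto-type Lévy measure). Then for every α₁ ∈ (1, e) there exist δ > 0 and C > 0 such that for all α₂ with α₁ < α₂ < min(α₁ + δ, e): ∫_ℝ ((c_{α₁}(v) − c_{α₂}(v))² ∧ 1) Π₀(dv) ≥ C (α₂ − α₁). In particular, the squared transportation distance of order 2 between these Pareto-type measures is bounded below linearly in |α₂ − α₁|, so the family is at best Hölder-1/2, not Lipschitz, continuous in α with respect to T₂. -/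
open MeasureTheory Set

/-- The transportation function `c_α(v) = (v/α)^{1/α} 1_{v > α^{1/α}}` of a
one-sided Pareto-type Lévy measure with exponent `α`. -/
noncomputable def cPareto (α : ℝ) (v : ℝ) : ℝ :=
  if α ^ (1 / α) < v then (v / α) ^ (1 / α) else 0

/-- The derivative of the threshold `x ^ (1 / x)`; it is positive exactly when `x < e`. -/
lemma hasDerivAt_rpow_one_div {x : ℝ} (hx : 0 < x) :
    HasDerivAt (fun y : ℝ => y ^ (1 / y)) (x ^ (1 / x) * ((1 - Real.log x) / x ^ 2)) x := by
  have h : HasDerivAt (fun y : ℝ => Real.exp (Real.log y / y))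
      (Real.exp (Real.log x / x) * ((x⁻¹ * x - Real.log x * 1) / x ^ 2)) x :=
    ((Real.hasDerivAt_log hx.ne').div (hasDerivAt_id x) hx.ne').exp
  have hexp : ∀ y : ℝ, 0 < y → y ^ (1 / y) = Real.exp (Real.log y / y) := fun y hy => by
    rw [Real.rpow_def_of_pos hy, mul_one_div]
  rw [inv_mul_cancel₀ hx.ne', mul_one, ← hexp x hx] at h
  refine h.congr_of_eventuallyEq ?_
  filter_upwards [lt_mem_nhds hx] with y hy using hexp y hy

/-- A function with positive derivative at `a` grows at least linearly to the right of `a`. -/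
lemma exists_linear_growth_of_hasDerivAt_pos {f : ℝ → ℝ} {a d : ℝ} (hf : HasDerivAt f d a)
    (hd : 0 < d) :
    ∃ δ > 0, ∀ b, a < b → b < a + δ → d / 2 * (b - a) ≤ f b - f a := by
  have h := (hasDerivAt_iff_tendsto_slope.1 hf).mono_left
    (nhdsWithin_mono a (fun x (hx : a < x) => hx.ne'))
  have hev := h.eventually (lt_mem_nhds (half_lt_self hd))
  obtain ⟨u, hu, hsub⟩ := mem_nhdsGT_iff_exists_Ioo_subset.1 hev
  refine ⟨u - a, sub_pos.2 hu, fun b hab hb => ?_⟩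
  have hs : d / 2 < slope f a b := hsub ⟨hab, by linarith⟩
  rw [slope_def_field, lt_div_iff₀ (sub_pos.2 hab)] at hs
  exact hs.le

lemma ofReal_mul_le_Pi0_Ioo {a b R : ℝ} (ha : 0 < a) (hb : b ≤ R) :
    ENNReal.ofReal (1 / R ^ 2 * (b - a)) ≤ Pi0 (Ioo a b) := by
  rw [Pi0, withDensity_apply _ measurableSet_Ioo, ENNReal.ofReal_mul (by positivity),
    ← Real.volume_Ioo, ← setLIntegral_const]
  refine setLIntegral_mono' measurableSet_Ioo fun v hv => ENNReal.ofReal_le_ofReal ?_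
  have hv0 : 0 < v := ha.trans hv.1
  have hvR : v ≤ R := hv.2.le.trans hb
  gcongr

/-- Between the two thresholds only the first transportation function is nonzero. -/
lemma le_sq_cPareto_sub {α β v : ℝ} (hα : 0 < α) (hv : v ∈ Ioo (α ^ (1 / α)) (β ^ (1 / β))) :
    ((α ^ (1 / α) / α) ^ (1 / α)) ^ 2 ≤ (cPareto α v - cPareto β v) ^ 2 := by
  rw [cPareto, cPareto, if_pos hv.1, if_neg hv.2.le.not_gt, sub_zero]
  have := hv.1.le
  gcongr

/-- The squared `T₂`-distance between one-sided Pareto-type measures is bounded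
below linearly in `α₂ - α₁`: the family is at best Hölder-1/2 in `α` w.r.t. `T₂`. -/
theorem pareto_T2_linear_lower_bound (α₁ : ℝ) (h1 : 1 < α₁) (h2 : α₁ < Real.exp 1) :
    ∃ δ > (0 : ℝ), ∃ C > (0 : ℝ), ∀ α₂ : ℝ, α₁ < α₂ → α₂ < min (α₁ + δ) (Real.exp 1) →
      ENNReal.ofReal (C * (α₂ - α₁)) ≤
        ∫⁻ v, ENNReal.ofReal (min ((cPareto α₁ v - cPareto α₂ v) ^ 2) 1) ∂Pi0 := by
  have hα : 0 < α₁ := by linarith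
  have hlog : Real.log α₁ < 1 := (Real.log_lt_iff_lt_exp hα).2 h2
  have hd : 0 < α₁ ^ (1 / α₁) * ((1 - Real.log α₁) / α₁ ^ 2) :=
    mul_pos (by positivity) (div_pos (sub_pos.2 hlog) (by positivity))
  obtain ⟨δ, hδ, hgrowth⟩ := exists_linear_growth_of_hasDerivAt_pos (hasDerivAt_rpow_one_div hα) hd
  set d := α₁ ^ (1 / α₁) * ((1 - Real.log α₁) / α₁ ^ 2)
  set m := min (((α₁ ^ (1 / α₁) / α₁) ^ (1 / α₁)) ^ 2) 1
  have hm : 0 < m := lt_min (by positivity) one_pos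
  refine ⟨δ, hδ, m * (1 / Real.exp 1 ^ 2 * (d / 2)), by positivity, fun α₂ h12 hα₂ => ?_⟩
  obtain ⟨hα₂δ, hα₂e⟩ := lt_min_iff.1 hα₂
  have hthreshold : α₂ ^ (1 / α₂) ≤ Real.exp 1 := by
    have h1' : 1 ≤ α₂ := by linarith
    calc α₂ ^ (1 / α₂) ≤ α₂ ^ (1 : ℝ) :=
          Real.rpow_le_rpow_of_exponent_le h1' ((div_le_one (by linarith)).2 h1')
      _ ≤ Real.exp 1 := by rw [Real.rpow_one]; exact hα₂e.le
  have hgap := hgrowth α₂ h12 hα₂δ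
  calc ENNReal.ofReal (m * (1 / Real.exp 1 ^ 2 * (d / 2)) * (α₂ - α₁))
      ≤ ENNReal.ofReal (m * (1 / Real.exp 1 ^ 2 * (α₂ ^ (1 / α₂) - α₁ ^ (1 / α₁)))) := by
        rw [mul_assoc, mul_assoc]
        gcongr
    _ ≤ ENNReal.ofReal m * Pi0 (Ioo (α₁ ^ (1 / α₁)) (α₂ ^ (1 / α₂))) := by
        rw [ENNReal.ofReal_mul hm.le]
        gcongr
        exact ofReal_mul_le_Pi0_Ioo (by positivity) hthreshold
    _ = ∫⁻ _ in Ioo (α₁ ^ (1 / α₁)) (α₂ ^ (1 / α₂)), ENNReal.ofReal m ∂Pi0 :=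
        (setLIntegral_const _ _).symm
    _ ≤ ∫⁻ v in Ioo (α₁ ^ (1 / α₁)) (α₂ ^ (1 / α₂)),
          ENNReal.ofReal (min ((cPareto α₁ v - cPareto α₂ v) ^ 2) 1) ∂Pi0 :=
        setLIntegral_mono' measurableSet_Ioo fun v hv =>
          ENNReal.ofReal_le_ofReal (min_le_min_right 1 (le_sq_cPareto_sub hα hv))
    _ ≤ ∫⁻ v, ENNReal.ofReal (min ((cPareto α₁ v - cPareto α₂ v) ^ 2) 1) ∂Pi0 :=
        setLIntegral_le_lintegral _ _
end

section
/- For every λ > 0 and all real exponents 2 ≤ α₁ < α₂: ∫_{1/λ}^{∞} (|(λy)^{1/α₁} − (λy)^{1/α₂}| ∧ 1) y^{−2} dy ≤ λ (α₁/(α₁ − 1) − α₂/(α₂ − 1)) ≤ λ (α₂ − α₁). -/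
open MeasureTheory Set

lemma integrableOn_Ioi_one_rpow_inv_sub_two {α : ℝ} (hα : 1 < α) :
    IntegrableOn (fun t : ℝ => t ^ (1 / α - 2)) (Ioi 1) := by
  have h : 1 / α < 1 := (div_lt_one (by linarith)).2 hα
  exact integrableOn_Ioi_rpow_of_lt (by linarith) one_pos

lemma integral_Ioi_one_rpow_inv_sub_two {α : ℝ} (hα : 1 < α) :
    ∫ t in Ioi (1 : ℝ), t ^ (1 / α - 2) = α / (α - 1) := by
  have h : 1 / α < 1 := (div_lt_one (by linarith)).2 hα
  rw [integral_Ioi_rpow_of_lt (by linarith) one_pos, Real.one_rpow]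
  have h0 : α ≠ 0 := by linarith
  have h1 : α - 1 ≠ 0 := by linarith
  have h2 : 1 / α - 2 + 1 ≠ 0 := by linarith
  rw [div_eq_div_iff h2 h1]
  field_simp
  ring

/-- The one-sided computation underlying the `T₁`-bound between polynomial Lévy
measures: for `λ > 0` and `2 ≤ α₁ < α₂`,
`∫_{1/λ}^∞ (|(λy)^{1/α₁} - (λy)^{1/α₂}| ∧ 1) y⁻² dy
  ≤ λ (α₁/(α₁-1) - α₂/(α₂-1)) ≤ λ (α₂ - α₁)`. -/
theorem one_sided_polynomial_T1_bound (lam : ℝ) (hlam : 0 < lam)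
    (α₁ α₂ : ℝ) (h1 : 2 ≤ α₁) (h12 : α₁ < α₂) :
    (∫ y in Ioi (1 / lam),
        min |(lam * y) ^ (1 / α₁) - (lam * y) ^ (1 / α₂)| 1 / y ^ 2)
      ≤ lam * (α₁ / (α₁ - 1) - α₂ / (α₂ - 1)) ∧
    lam * (α₁ / (α₁ - 1) - α₂ / (α₂ - 1)) ≤ lam * (α₂ - α₁) := by
  have hα₁ : 1 < α₁ := by linarith
  have hα₂ : 1 < α₂ := by linarith
  constructor
  · set g : ℝ → ℝ := fun t => t ^ (1 / α₁ - 2) - t ^ (1 / α₂ - 2) with hg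
    have hgi : IntegrableOn g (Ioi 1) :=
      (integrableOn_Ioi_one_rpow_inv_sub_two hα₁).sub
        (integrableOn_Ioi_one_rpow_inv_sub_two hα₂)
    have hgv : ∫ t in Ioi (1 : ℝ), g t = α₁ / (α₁ - 1) - α₂ / (α₂ - 1) := by
      rw [hg, integral_sub (integrableOn_Ioi_one_rpow_inv_sub_two hα₁)
        (integrableOn_Ioi_one_rpow_inv_sub_two hα₂),
        integral_Ioi_one_rpow_inv_sub_two hα₁, integral_Ioi_one_rpow_inv_sub_two hα₂]
    have hone : lam * (1 / lam) = 1 := by field_simp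
    have hgl : IntegrableOn (fun y => g (lam * y)) (Ioi (1 / lam)) := by
      rw [integrableOn_Ioi_comp_mul_left_iff g _ hlam, hone]
      exact hgi
    calc _ ≤ ∫ y in Ioi (1 / lam), lam ^ 2 * g (lam * y) := by
          refine integral_mono_of_nonneg (ae_of_all _ fun y => by positivity)
            (hgl.const_mul _) ?_
          filter_upwards [ae_restrict_mem measurableSet_Ioi] with y hy
          have hy0 : 0 < y := (one_div_pos.2 hlam).trans hy
          have ht : 1 < lam * y := by
            rw [← hone]
            exact mul_lt_mul_of_pos_left hy hlam
          have ht0 : 0 < lam * y := one_pos.trans ht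
          have hle : (lam * y) ^ (1 / α₂) ≤ (lam * y) ^ (1 / α₁) :=
            Real.rpow_le_rpow_of_exponent_le ht.le
              (one_div_le_one_div_of_le (by linarith) h12.le)
          have heq : lam ^ 2 * g (lam * y)
              = ((lam * y) ^ (1 / α₁) - (lam * y) ^ (1 / α₂)) / y ^ 2 := by
            simp only [hg, Real.rpow_sub ht0, Real.rpow_two]
            field_simp
          rw [heq]
          gcongr
          exact (min_le_left _ _).trans_eq (abs_of_nonneg (sub_nonneg.2 hle))
      _ = lam * (α₁ / (α₁ - 1) - α₂ / (α₂ - 1)) := by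
          rw [integral_const_mul, integral_comp_mul_left_Ioi g _ hlam, hone, hgv, smul_eq_mul]
          field_simp
  · have hp₁ : 0 < α₁ - 1 := by linarith
    have hp₂ : 0 < α₂ - 1 := by linarith
    have heq : α₁ / (α₁ - 1) - α₂ / (α₂ - 1) = (α₂ - α₁) / ((α₁ - 1) * (α₂ - 1)) := by
      field_simp
      ring
    rw [heq]
    gcongr
    exact div_le_self (by linarith) (by nlinarith)
end

section
/- Let 0 < a < b, let λ > 0, c > 1, and α > 0 with α ≠ 1. Define q_c(x) = (λ/α)^{1/α} · x^{1/α − 1}/(1/α − 1) + c/x for x > 0, the crossing points κ̃⁻ = (α/λ)(c−1)^α, κ̃⁰ = (α/λ) c^α, κ̃⁺ = (α/λ)(c+1)^α, and their truncations to (a, b]: κ^⋆ = (a ∨ κ̃^⋆) ∧ b for ⋆ ∈ {−, 0, +}. Then ∫_a^b (|c − (λv/α)^{1/α}| ∧ 1) v^{−2} dv = q_c(κ⁻) + q_c(κ⁺) − 2 q_c(κ⁰) + 1/a − 1/b + 1/κ⁺ − 1/κ⁻. -/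
open MeasureTheory Set

/-- `q_c(x) = (λ/α)^{1/α} x^{1/α-1}/(1/α-1) + c/x`. -/
noncomputable def qfun (c lam α x : ℝ) : ℝ :=
  (lam / α) ^ (1 / α) * x ^ (1 / α - 1) / (1 / α - 1) + c / x

/-- The crossing point `(α/λ) s^α` truncated to the interval `(a,b]`. -/
noncomputable def kappa (lam α a b s : ℝ) : ℝ :=
  min (max a (α / lam * s ^ α)) b

lemma lt_crossing_iff {lam α s v : ℝ} (hlam : 0 < lam) (hα : 0 < α) (hs : 0 < s) (hv : 0 < v) :
    v < α / lam * s ^ α ↔ (lam * v / α) ^ (1 / α) < s := by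
  rw [one_div, Real.rpow_inv_lt_iff_of_pos (by positivity) hs.le hα, div_lt_iff₀ hα,
    div_mul_eq_mul_div, lt_div_iff₀ hlam]
  constructor <;> intro h <;> linarith

lemma crossing_lt_iff {lam α s v : ℝ} (hlam : 0 < lam) (hα : 0 < α) (hs : 0 < s) (hv : 0 < v) :
    α / lam * s ^ α < v ↔ s < (lam * v / α) ^ (1 / α) := by
  rw [one_div, Real.lt_rpow_inv_iff_of_pos hs.le (by positivity) hα, lt_div_iff₀ hα,
    div_mul_eq_mul_div, div_lt_iff₀ hlam]
  constructor <;> intro h <;> linarith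

lemma le_kappa {lam α a b s : ℝ} (hab : a < b) : a ≤ kappa lam α a b s :=
  le_min (le_max_left _ _) hab.le

lemma kappa_le {lam α a b s : ℝ} : kappa lam α a b s ≤ b := min_le_right _ _

lemma kappa_mono {lam α a b s t : ℝ} (hlam : 0 < lam) (hα : 0 < α) (hs : 0 < s) (hst : s ≤ t) :
    kappa lam α a b s ≤ kappa lam α a b t := by
  unfold kappa
  gcongr

lemma rpow_lt_of_lt_kappa {lam α a b s v : ℝ} (hlam : 0 < lam) (hα : 0 < α) (hs : 0 < s)
    (ha : 0 < a) (hav : a < v) (hv : v < kappa lam α a b s) :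
    (lam * v / α) ^ (1 / α) < s := by
  rw [← lt_crossing_iff hlam hα hs (ha.trans hav)]
  exact (lt_max_iff.1 (lt_min_iff.1 hv).1).resolve_left hav.not_gt

lemma lt_rpow_of_kappa_lt {lam α a b s v : ℝ} (hlam : 0 < lam) (hα : 0 < α) (hs : 0 < s)
    (hv0 : 0 < v) (hvb : v < b) (hv : kappa lam α a b s < v) :
    s < (lam * v / α) ^ (1 / α) := by
  rw [← crossing_lt_iff hlam hα hs hv0]
  exact (max_lt_iff.1 ((min_lt_iff.1 hv).resolve_right hvb.not_gt)).2

lemma hasDerivAt_qfun {c lam α x : ℝ} (hlam : 0 < lam) (hα : 0 < α) (hα1 : α ≠ 1) (hx : 0 < x) :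
    HasDerivAt (qfun c lam α) (((lam * x / α) ^ (1 / α) - c) / x ^ 2) x := by
  have hne : 1 / α - 1 ≠ 0 := by
    rw [sub_ne_zero, ne_eq, div_eq_one_iff_eq hα.ne']
    exact hα1.symm
  have h := ((((Real.hasDerivAt_rpow_const (p := 1 / α - 1) (Or.inl hx.ne')).const_mul
    ((lam / α) ^ (1 / α))).div_const (1 / α - 1))).add ((hasDerivAt_inv hx.ne').const_mul c)
  refine (h.congr_deriv ?_).congr_of_eventuallyEq (.of_forall fun y => ?_)
  · rw [mul_left_comm, mul_div_cancel_left₀ _ hne, mul_div_right_comm lam x α, Real.mul_rpow (by positivity) hx.le,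
      show 1 / α - 1 - 1 = 1 / α - (2 : ℕ) by push_cast; ring, Real.rpow_sub_natCast hx.ne']
    field_simp
    ring
  · simp [qfun, div_eq_mul_inv]

lemma hasDerivAt_neg_one_div {x : ℝ} (hx : 0 < x) :
    HasDerivAt (fun y : ℝ => -(1 / y)) (1 / x ^ 2) x := by
  simpa [one_div, Pi.neg_def] using (hasDerivAt_inv hx.ne').neg

lemma intervalIntegrable_truncated_pareto {c lam α x y : ℝ} (hα : 0 < α)
    (hx : 0 < x) (hxy : x ≤ y) :
    IntervalIntegrable (fun v => min |c - (lam * v / α) ^ (1 / α)| 1 / v ^ 2) volume x y := by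
  refine ContinuousOn.intervalIntegrable_of_Icc hxy ?_
  refine ContinuousOn.div ?_ (by fun_prop) fun v hv => (pow_pos (hx.trans_le hv.1) 2).ne'
  have h : Continuous fun v : ℝ => (lam * v / α) ^ (1 / α) :=
    Continuous.rpow_const (by fun_prop) fun _ => Or.inr (by positivity)
  exact ((continuous_const.sub h).abs.min continuous_const).continuousOn

/-- Fundamental theorem of calculus for a positive interval on which the integrand is the
derivative of `F` in the interior. -/
lemma integral_truncated_pareto_eq_sub {c lam α x y : ℝ} {F g : ℝ → ℝ} (hα : 0 < α)
    (hx : 0 < x) (hxy : x ≤ y) (hF : ∀ v, 0 < v → HasDerivAt F (g v / v ^ 2) v)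
    (hg : ∀ v ∈ Ioo x y, min |c - (lam * v / α) ^ (1 / α)| 1 = g v) :
    (∫ v in x..y, min |c - (lam * v / α) ^ (1 / α)| 1 / v ^ 2) = F y - F x :=
  intervalIntegral.integral_eq_sub_of_hasDerivAt_of_le hxy
    (fun v hv => (hF v (hx.trans_le hv.1)).continuousAt.continuousWithinAt)
    (fun v hv => by rw [hg v hv]; exact hF v (hx.trans hv.1))
    (intervalIntegrable_truncated_pareto hα hx hxy)

/-- Exact formula for the truncated integral
`∫_a^b (|c - (λv/α)^{1/α}| ∧ 1) v⁻² dv` in terms of `q_c` evaluated at the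
truncated crossing points `κ⁻, κ⁰, κ⁺`. -/
theorem integral_truncated_pareto_formula (a b c lam α : ℝ)
    (ha : 0 < a) (hab : a < b) (hc : 1 < c) (hlam : 0 < lam)
    (hα : 0 < α) (hα1 : α ≠ 1) :
    (∫ v in Ioc a b, min |c - (lam * v / α) ^ (1 / α)| 1 / v ^ 2) =
      qfun c lam α (kappa lam α a b (c - 1)) + qfun c lam α (kappa lam α a b (c + 1))
        - 2 * qfun c lam α (kappa lam α a b c)
        + 1 / a - 1 / b
        + 1 / kappa lam α a b (c + 1) - 1 / kappa lam α a b (c - 1) := by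
  have hm0 : kappa lam α a b (c - 1) ≤ kappa lam α a b c :=
    kappa_mono hlam hα (by linarith) (by linarith)
  have h0p : kappa lam α a b c ≤ kappa lam α a b (c + 1) :=
    kappa_mono hlam hα (by linarith) (by linarith)
  have ham : a ≤ kappa lam α a b (c - 1) := le_kappa hab
  have hpb : kappa lam α a b (c + 1) ≤ b := kappa_le
  have hlow : ∀ {s v : ℝ}, 0 < s → a < v → v < kappa lam α a b s →
      (lam * v / α) ^ (1 / α) < s := fun hs => rpow_lt_of_lt_kappa hlam hα hs ha
  have hupp : ∀ {s v : ℝ}, 0 < s → a < v → v < b → kappa lam α a b s < v →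
      s < (lam * v / α) ^ (1 / α) := fun hs hv => lt_rpow_of_kappa_lt hlam hα hs (ha.trans hv)
  have hm : 0 < kappa lam α a b (c - 1) := ha.trans_le ham
  have hz := hm.trans_le hm0
  have hp := hz.trans_le h0p
  have i1 := integral_truncated_pareto_eq_sub (c := c) (lam := lam) (g := fun _ => 1) hα ha ham
    (fun v => hasDerivAt_neg_one_div) fun v hv => by
      have := hlow (by linarith) hv.1 hv.2
      exact min_eq_right (le_abs.2 (Or.inl (by linarith)))
  have i2 := integral_truncated_pareto_eq_sub (c := c) (lam := lam) (F := fun v => -qfun c lam α v)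
    (g := fun v => c - (lam * v / α) ^ (1 / α)) hα hm hm0
    (fun v hv => (hasDerivAt_qfun hlam hα hα1 hv).neg.congr_deriv (by ring)) fun v hv => by
      have h1 := hlow (by linarith) (ham.trans_lt hv.1) hv.2
      have h2 := hupp (by linarith) (ham.trans_lt hv.1) (by linarith [hv.2]) hv.1
      rw [abs_of_pos (by linarith), min_eq_left (by linarith)]
  have i3 := integral_truncated_pareto_eq_sub (c := c) (lam := lam)
    (g := fun v => (lam * v / α) ^ (1 / α) - c) hα hz h0p
    (fun v hv => hasDerivAt_qfun hlam hα hα1 hv) fun v hv => by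
      have h1 := hlow (by linarith) (by linarith [hv.1]) hv.2
      have h2 := hupp (by linarith) (by linarith [hv.1]) (by linarith [hv.2]) hv.1
      rw [abs_of_neg (by linarith), min_eq_left (by linarith), neg_sub]
  have i4 := integral_truncated_pareto_eq_sub (c := c) (lam := lam) (g := fun _ => 1) hα hp hpb
    (fun v => hasDerivAt_neg_one_div) fun v hv => by
      have := hupp (by linarith) (by linarith [hv.1]) hv.2 hv.1
      exact min_eq_right (le_abs.2 (Or.inr (by linarith)))
  have hint : ∀ {x y : ℝ}, 0 < x → x ≤ y → IntervalIntegrable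
      (fun v => min |c - (lam * v / α) ^ (1 / α)| 1 / v ^ 2) volume x y :=
    intervalIntegrable_truncated_pareto hα
  rw [← intervalIntegral.integral_of_le hab.le,
    ← intervalIntegral.integral_add_adjacent_intervals (hint ha ham) (hint hm (by linarith)),
    ← intervalIntegral.integral_add_adjacent_intervals (hint hm hm0) (hint hz (by linarith)),
    ← intervalIntegral.integral_add_adjacent_intervals (hint hz h0p) (hint hp hpb),
    i1, i2, i3, i4]
  ring
end

section
/- Let F(y) = arctan(y²) and τ(u) = sign(u)(|u| ∧ 1). Let ζ₁, ζ₂ : ℝ → ℝ be Borel measurable with T² := ∫ ((ζ₁(v) − ζ₂(v))² ∧ 1) Π₀(dv) < ∞ and Π₀(|ζᵢ| > 1) < ∞ for i = 1, 2. Then for every y ∈ ℝ: ∫_ℝ [F(y + ζ₁(v) − ζ₂(v)) − F(y) − F'(y)(τ(ζ₁(v)) − τ(ζ₂(v)))] Π₀(dv) ≤ 2 |F'(y)| · T · (Π₀({v : |ζ₁(v)| > 1}) + Π₀({v : |ζ₂(v)| > 1}))^{1/2} + (π + 3^{3/4}/2) · T². -/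
open MeasureTheory Set

/-- The Lipschitz cutoff function `τ(u) = sign(u)(|u| ∧ 1)`. -/
noncomputable def tau (u : ℝ) : ℝ := Real.sign u * min |u| 1

theorem tau_eq_max_min (u : ℝ) : tau u = max (-1) (min u 1) := by
  unfold tau
  rcases lt_trichotomy u 0 with h | h | h
  · rw [Real.sign_of_neg h, abs_of_neg h, min_eq_left (by linarith : u ≤ 1)]
    rcases le_total (-u) 1 with h' | h'
    · rw [min_eq_left h', max_eq_right (by linarith)]; ring
    · rw [min_eq_right h', max_eq_left (by linarith)]; ring
  · simp [h]
  · rw [Real.sign_of_pos h, abs_of_pos h, one_mul,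
      max_eq_right (by linarith [lt_min h one_pos])]

theorem tau_of_abs_le_one {u : ℝ} (h : |u| ≤ 1) : tau u = u := by
  rw [tau_eq_max_min, min_eq_left (abs_le.1 h).2, max_eq_right (abs_le.1 h).1]

theorem abs_tau_le_one (u : ℝ) : |tau u| ≤ 1 := by
  rw [tau_eq_max_min, abs_le]
  exact ⟨le_max_left _ _, max_le (by norm_num) (min_le_right _ _)⟩

theorem abs_tau_sub_tau_le (a b : ℝ) : |tau a - tau b| ≤ |a - b| := by
  rw [tau_eq_max_min, tau_eq_max_min]
  calc |max (-1) (min a 1) - max (-1) (min b 1)|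
      ≤ |min a 1 - min b 1| := by
        simpa [max_comm] using abs_max_sub_max_le_abs (min a 1) (min b 1) (-1)
    _ ≤ |a - b| := by simpa using abs_min_sub_min_le_max a 1 b 1

/-- Tangent line bound for `arctan`, which is concave on the nonnegative half-line. -/
theorem arctan_sub_arctan_le {s t : ℝ} (hs : 0 ≤ s) (ht : 0 ≤ t) :
    Real.arctan s - Real.arctan t ≤ (s - t) / (1 + t ^ 2) := by
  rcases le_total t s with h | h
  · have := (convex_Icc t s).image_sub_le_mul_sub_of_deriv_le (f := Real.arctan)
      (C := 1 / (1 + t ^ 2)) Real.continuous_arctan.continuousOn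
      Real.differentiable_arctan.differentiableOn
      (fun x hx => by
        rw [interior_Icc] at hx
        have := hx.1
        rw [Real.deriv_arctan]
        exact one_div_le_one_div_of_le (by positivity) (by nlinarith)) t (left_mem_Icc.2 h) s (right_mem_Icc.2 h) h
    rwa [one_div_mul_eq_div] at this
  · have := (convex_Icc s t).mul_sub_le_image_sub_of_le_deriv (f := Real.arctan)
      (C := 1 / (1 + t ^ 2)) Real.continuous_arctan.continuousOn
      Real.differentiable_arctan.differentiableOn
      (fun x hx => by
        rw [interior_Icc] at hx
        have h1 := hx.1
        have h2 := hx.2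
        rw [Real.deriv_arctan]
        exact one_div_le_one_div_of_le (by positivity) (by nlinarith)) s (left_mem_Icc.2 h) t (right_mem_Icc.2 h) h
    rw [one_div_mul_eq_div] at this
    have h3 : (s - t) / (1 + t ^ 2) = -((t - s) / (1 + t ^ 2)) := by ring
    linarith

theorem arctan_sq_add_le (y d : ℝ) :
    Real.arctan ((y + d) ^ 2) - Real.arctan (y ^ 2) - 2 * y / (1 + y ^ 4) * d ≤ d ^ 2 := by
  have h := arctan_sub_arctan_le (sq_nonneg (y + d)) (sq_nonneg y)
  have h4 : (y ^ 2) ^ 2 = y ^ 4 := by ring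
  rw [h4] at h
  have hy : (0 : ℝ) ≤ y ^ 4 := by positivity
  have h5 : ((y + d) ^ 2 - y ^ 2) / (1 + y ^ 4)
      = 2 * y / (1 + y ^ 4) * d + d ^ 2 / (1 + y ^ 4) := by ring
  have h6 : d ^ 2 / (1 + y ^ 4) ≤ d ^ 2 := div_le_self (sq_nonneg d) (by linarith)
  linarith

theorem arctan_sq_sub_arctan_sq_le (x y : ℝ) :
    Real.arctan (x ^ 2) - Real.arctan (y ^ 2) ≤ Real.pi / 2 := by
  have h1 := Real.arctan_lt_pi_div_two (x ^ 2)
  have h2 : 0 ≤ Real.arctan (y ^ 2) := Real.arctan_nonneg.2 (sq_nonneg y)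
  linarith

theorem abs_two_mul_div_one_add_pow_four_le (y : ℝ) : |2 * y / (1 + y ^ 4)| ≤ 6 / 5 := by
  have hy : (0 : ℝ) < 1 + y ^ 4 := by positivity
  rw [abs_div, abs_of_pos hy, div_le_iff₀ hy, abs_le]
  constructor <;>
    nlinarith [sq_nonneg (y ^ 2 - 1 / 2), sq_nonneg (y - 5 / 6), sq_nonneg (y + 5 / 6)]

theorem two_mul_abs_deriv_le (y : ℝ) :
    2 * |2 * y / (1 + y ^ 4)| ≤ Real.pi / 2 + 3 ^ ((3 : ℝ) / 4) / 2 := by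
  have h := abs_two_mul_div_one_add_pow_four_le y
  have h1 : (3 : ℝ) ^ ((1 : ℝ) / 2) ≤ 3 ^ ((3 : ℝ) / 4) :=
    Real.rpow_le_rpow_of_exponent_le (by norm_num) (by norm_num)
  rw [← Real.sqrt_eq_rpow] at h1
  have h2 : (1.7 : ℝ) ≤ √3 := Real.le_sqrt_of_sq_le (by norm_num)
  linarith [Real.pi_gt_d2]

/-- Pointwise bound on the compensated increment of `arctan (y ^ 2)`. -/
theorem jump_integrand_le (y a b : ℝ) :
    Real.arctan ((y + a - b) ^ 2) - Real.arctan (y ^ 2)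
        - 2 * y / (1 + y ^ 4) * (tau a - tau b)
      ≤ 2 * |2 * y / (1 + y ^ 4)|
          * (√(min ((a - b) ^ 2) 1) * if 1 < |a| ∨ 1 < |b| then 1 else 0)
        + (Real.pi + 3 ^ ((3 : ℝ) / 4) / 2) * min ((a - b) ^ 2) 1 := by
  have hF := two_mul_abs_deriv_le y
  have h1 := arctan_sq_add_le y (a - b)
  have h2 := arctan_sq_sub_arctan_sq_le (y + (a - b)) y
  rw [add_sub_assoc]
  set F := 2 * y / (1 + y ^ 4)
  have hlip := abs_tau_sub_tau_le a b
  have htwo : |tau a - tau b| ≤ 2 := by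
    linarith [abs_sub (tau a) (tau b), abs_tau_le_one a, abs_tau_le_one b]
  have hr : (0 : ℝ) ≤ 3 ^ ((3 : ℝ) / 4) := by positivity
  have hpi := Real.pi_gt_three
  have hF0 := abs_nonneg F
  have hneg (u : ℝ) : -(F * u) ≤ |F| * |u| := by
    rw [← abs_mul]; exact neg_le_abs _
  rcases le_or_gt |a - b| 1 with hd | hd
  · have hm : (a - b) ^ 2 ≤ 1 := (sq_le_one_iff_abs_le_one _).2 hd
    have hsq := sq_nonneg (a - b)
    rw [min_eq_left hm, Real.sqrt_sq_eq_abs]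
    split_ifs with hA
    · have h3 := hneg (tau a - tau b - (a - b))
      have h4 : |tau a - tau b - (a - b)| ≤ 2 * |a - b| := by
        linarith [abs_sub (tau a - tau b) (a - b)]
      have h5 := mul_le_mul_of_nonneg_left h4 hF0
      nlinarith
    · push Not at hA
      rw [tau_of_abs_le_one hA.1, tau_of_abs_le_one hA.2]
      nlinarith
  · have hm : 1 ≤ (a - b) ^ 2 := ((one_lt_sq_iff_one_lt_abs _).2 hd).le
    rw [min_eq_right hm, Real.sqrt_one]
    have h3 := hneg (tau a - tau b)
    have h5 := mul_le_mul_of_nonneg_left htwo hF0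
    split_ifs <;> linarith

/-- Cauchy–Schwarz for the integral of `√f` over a set of finite measure. -/
theorem integral_sqrt_indicator_le {α : Type*} [MeasurableSpace α] {μ : Measure α}
    {f : α → ℝ} (hf : Integrable f μ) (hf0 : 0 ≤ f) {A : Set α} (hA : MeasurableSet A)
    (hμA : μ A ≠ ⊤) :
    Integrable (fun x => √(f x) * A.indicator 1 x) μ ∧
      ∫ x, √(f x) * A.indicator 1 x ∂μ ≤ √(∫ x, f x ∂μ) * √(μ A).toReal := by
  have hsq (x : α) : √(f x) ^ 2 = f x := Real.sq_sqrt (hf0 x)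
  have h1 : MemLp (fun x => √(f x)) 2 μ := by
    rw [memLp_two_iff_integrable_sq
      (Real.continuous_sqrt.comp_aestronglyMeasurable hf.aestronglyMeasurable)]
    simpa only [hsq] using hf
  have h2 : MemLp (A.indicator (1 : α → ℝ)) 2 μ :=
    memLp_indicator_const 2 hA (1 : ℝ) (Or.inr hμA)
  refine ⟨h1.integrable_mul h2, ?_⟩
  have h := integral_mul_le_Lp_mul_Lq_of_nonneg (μ := μ) (f := fun x => √(f x))
    (g := A.indicator 1) Real.HolderConjugate.two_two
    (Filter.Eventually.of_forall fun x => Real.sqrt_nonneg (f x))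
    (Filter.Eventually.of_forall fun x => indicator_nonneg (fun _ _ => zero_le_one) x)
    (by simpa using h1) (by simpa using h2)
  have h3 (x : α) : A.indicator (1 : α → ℝ) x ^ 2 = A.indicator 1 x := by
    by_cases hx : x ∈ A <;> simp [hx]
  simp only [Real.rpow_two, hsq, h3, ← Real.sqrt_eq_rpow] at h
  rwa [integral_indicator_one hA] at h

/-- The key bound on the jump term `g₃`: for `F(y) = arctan(y²)` with
`F'(y) = 2y/(1+y⁴)`,
`∫ [F(y + ζ₁ - ζ₂) - F(y) - F'(y)(τ(ζ₁) - τ(ζ₂))] dΠ₀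
  ≤ 2|F'(y)| T (Π₀(|ζ₁|>1) + Π₀(|ζ₂|>1))^{1/2} + (π + 3^{3/4}/2) T²`,
where `T² = ∫ ((ζ₁ - ζ₂)² ∧ 1) dΠ₀`. -/
theorem g3_jump_term_bound (ζ₁ ζ₂ : ℝ → ℝ)
    (hζ₁ : Measurable ζ₁) (hζ₂ : Measurable ζ₂) (y : ℝ)
    (hT : Integrable (fun v => min ((ζ₁ v - ζ₂ v) ^ 2) 1) Pi0)
    (hm1 : Pi0 {v | 1 < |ζ₁ v|} < ⊤) (hm2 : Pi0 {v | 1 < |ζ₂ v|} < ⊤) :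
    (∫ v, (Real.arctan ((y + ζ₁ v - ζ₂ v) ^ 2) - Real.arctan (y ^ 2)
        - (2 * y / (1 + y ^ 4)) * (tau (ζ₁ v) - tau (ζ₂ v))) ∂Pi0)
      ≤ 2 * |2 * y / (1 + y ^ 4)|
          * Real.sqrt (∫ v, min ((ζ₁ v - ζ₂ v) ^ 2) 1 ∂Pi0)
          * Real.sqrt ((Pi0 {v | 1 < |ζ₁ v|}).toReal + (Pi0 {v | 1 < |ζ₂ v|}).toReal)
        + (Real.pi + 3 ^ ((3 : ℝ) / 4) / 2)
          * (∫ v, min ((ζ₁ v - ζ₂ v) ^ 2) 1 ∂Pi0) := by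
  have hA : MeasurableSet ({v | 1 < |ζ₁ v|} ∪ {v | 1 < |ζ₂ v|}) :=
    (measurableSet_lt measurable_const hζ₁.abs).union (measurableSet_lt measurable_const hζ₂.abs)
  set A := {v | 1 < |ζ₁ v|} ∪ {v | 1 < |ζ₂ v|} with hA_def
  have hμA : Pi0 A ≤ Pi0 {v | 1 < |ζ₁ v|} + Pi0 {v | 1 < |ζ₂ v|} := measure_union_le _ _
  have hsum : Pi0 {v | 1 < |ζ₁ v|} + Pi0 {v | 1 < |ζ₂ v|} ≠ ⊤ :=
    ENNReal.add_ne_top.2 ⟨hm1.ne, hm2.ne⟩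
  have hμA' : (Pi0 A).toReal
      ≤ (Pi0 {v | 1 < |ζ₁ v|}).toReal + (Pi0 {v | 1 < |ζ₂ v|}).toReal := by
    rw [← ENNReal.toReal_add hm1.ne hm2.ne]
    exact ENNReal.toReal_mono hsum hμA
  have hm0 : 0 ≤ fun v => min ((ζ₁ v - ζ₂ v) ^ 2) 1 := fun v =>
    le_min (sq_nonneg _) zero_le_one
  obtain ⟨hint, hCS⟩ := integral_sqrt_indicator_le hT hm0 hA (ne_top_of_le_ne_top hsum hμA)
  have hCS' := hCS.trans (mul_le_mul_of_nonneg_left (Real.sqrt_le_sqrt hμA') (Real.sqrt_nonneg _))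
  by_cases hL : Integrable (fun v => Real.arctan ((y + ζ₁ v - ζ₂ v) ^ 2) - Real.arctan (y ^ 2)
      - (2 * y / (1 + y ^ 4)) * (tau (ζ₁ v) - tau (ζ₂ v))) Pi0
  · have hle := integral_mono hL
      ((hint.const_mul (2 * |2 * y / (1 + y ^ 4)|)).add
        (hT.const_mul (Real.pi + 3 ^ ((3 : ℝ) / 4) / 2)))
      (fun v => by
        have := jump_integrand_le y (ζ₁ v) (ζ₂ v)
        simpa [hA_def, indicator_apply] using this)
    simp only [Pi.add_apply] at hle
    rw [integral_add (hint.const_mul _) (hT.const_mul _), integral_const_mul,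
      integral_const_mul] at hle
    refine hle.trans (add_le_add_left ?_ _)
    rw [mul_assoc (2 * |2 * y / (1 + y ^ 4)|)]
    exact mul_le_mul_of_nonneg_left hCS' (by positivity)
  · rw [integral_undef hL]
    have : 0 ≤ ∫ v, min ((ζ₁ v - ζ₂ v) ^ 2) 1 ∂Pi0 := integral_nonneg hm0
    have := Real.pi_pos
    positivity
end
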